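/- The set B = {φ₁+φ₂+φ₃+φ₄, −(φ₁+2φ₂+2φ₃), φ₂, φ₃} is a base of Δ, and the positive system determined by B equals Δ_k⁺ ∪ {β ∈ Δ_n⁺ : β ≥ φ₁+φ₂+φ₃+φ₄} ∪ (−{β ∈ Δ_n⁺ : β ≤ φ₁+2φ₂+2φ₃}); in particular this positive system contains Δ_k⁺. -/

import Mathlib

noncomputable section

abbrev V : Type := Fin 4 → ℝ

def e (i : Fin 4) : V := Pi.single i 1

/-- The root system of type F₄ in ℝ⁴ (48 vectors). -/
def Δ : Set V :=
  (⋃ i, ({e i, -e i} : Set V)) ∪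
  (⋃ (i) (j) (_ : i < j), ({e i + e j, e i - e j, -e i + e j, -e i - e j} : Set V)) ∪
  {v | ∃ s : Fin 4 → ℝ, (∀ i, s i = 1 ∨ s i = -1) ∧ v = (1 / 2 : ℝ) • ∑ i, s i • e i}

def φ₁ : V := e 1 - e 2
def φ₂ : V := e 2 - e 3
def φ₃ : V := e 3
def φ₄ : V := (1 / 2 : ℝ) • (e 0 - e 1 - e 2 - e 3)

def φv : Fin 4 → V := ![φ₁, φ₂, φ₃, φ₄]

/-- The coordinates `n₁(α), …, n₄(α)` of `α` with respect to the basis φ₁,…,φ₄: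
for every `α : V` one has `α = ∑ i, n α i • φv i`. -/
def n (α : V) : Fin 4 → ℝ :=
  ![α 1 + α 0, α 1 + α 2 + 2 * α 0, α 1 + α 2 + α 3 + 3 * α 0, 2 * α 0]

/-- The highest root δ = 2φ₁+3φ₂+4φ₃+2φ₄ = e₁+e₂. -/
def δ : V := e 0 + e 1

/-- Compact roots: roots α with n₁(α) even. -/
def Δk : Set V := {α ∈ Δ | ∃ m : ℤ, n α 0 = 2 * m}

/-- Noncompact roots: roots α with n₁(α) odd. -/
def Δn : Set V := {α ∈ Δ | ∃ m : ℤ, n α 0 = 2 * m + 1}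

/-- Δ⁺: roots with all φ-coefficients nonnegative. -/
def Δp : Set V := {α ∈ Δ | ∀ i, 0 ≤ n α i}

def Δkp : Set V := Δp ∩ Δk
def Δnp : Set V := Δp ∩ Δn

/-- A positive system of Δ: the set of roots on which some root-regular linear
functional is positive. -/
def IsPosSystem (P : Set V) : Prop :=
  ∃ f : V →ₗ[ℝ] ℝ, (∀ α ∈ Δ, f α ≠ 0) ∧ P = {α ∈ Δ | 0 < f α}

/-- `le' γ β` means γ ≤ β, i.e. β − γ is a nonnegative integer combination of φ₁,…,φ₄. -/
def le' (γ β : V) : Prop := ∃ c : Fin 4 → ℕ, β - γ = ∑ i, (c i : ℝ) • φv i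

/-- A base of Δ: a linearly independent subset of Δ such that every root is an
integral combination with coefficients all ≥ 0 or all ≤ 0. -/
def IsBase (B : Finset V) : Prop :=
  ↑B ⊆ Δ ∧ LinearIndependent ℝ (Subtype.val : {x : V // x ∈ B} → V) ∧
  ∀ α ∈ Δ, ∃ c : V → ℤ,
    α = ∑ x ∈ B, (c x : ℝ) • x ∧ ((∀ x ∈ B, 0 ≤ c x) ∨ (∀ x ∈ B, c x ≤ 0))

/-- The positive system determined by a base B: roots whose B-coefficients are all ≥ 0. -/
def posOf (B : Finset V) : Set V :=
  {α ∈ Δ | ∃ c : V → ℤ, α = ∑ x ∈ B, (c x : ℝ) • x ∧ ∀ x ∈ B, 0 ≤ c x}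

theorem n_apply_neg (α : V) (i : Fin 4) : n (-α) i = -n α i := by
  fin_cases i <;> simp [n] <;> ring

theorem n_apply_sub (α β : V) (i : Fin 4) : n (α - β) i = n α i - n β i := by
  fin_cases i <;> simp [n] <;> ring

theorem eq_sum_φv_iff (α : V) (c : Fin 4 → ℝ) :
    α = ∑ i, c i • φv i ↔ ∀ i, n α i = c i := by
  constructor
  · rintro rfl i
    fin_cases i <;>
      simp [n, φv, φ₁, φ₂, φ₃, φ₄, e, Fin.sum_univ_four] <;> ring
  · intro h
    ext j
    simp only [← h]
    fin_cases j <;>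
      simp [n, φv, φ₁, φ₂, φ₃, φ₄, e, Fin.sum_univ_four] <;> ring

/-- In integral coordinates with respect to the simple roots, `le'` is the coordinatewise order. -/
theorem le'_iff {β γ : V} {y z : Fin 4 → ℤ} (hγ : ∀ i, n γ i = y i) (hβ : ∀ i, n β i = z i) :
    le' γ β ↔ ∀ i, y i ≤ z i := by
  simp only [le', eq_sum_φv_iff, n_apply_sub, hβ, hγ]
  constructor
  · rintro ⟨c, hc⟩ i
    have : z i - y i = c i := by exact_mod_cast hc i
    omega
  · intro h
    refine ⟨fun i => (z i - y i).toNat, fun i => ?_⟩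
    have : z i - y i = ((z i - y i).toNat : ℤ) := by have := h i; omega
    exact_mod_cast this

theorem n_lower (i : Fin 4) : n (φ₁ + φ₂ + φ₃ + φ₄) i = ((![1, 1, 1, 1] : Fin 4 → ℤ) i : ℝ) := by
  fin_cases i <;> simp [n, φ₁, φ₂, φ₃, φ₄, e] <;> norm_num

theorem n_upper (i : Fin 4) :
    n (φ₁ + (2 : ℝ) • φ₂ + (2 : ℝ) • φ₃) i = ((![1, 2, 2, 0] : Fin 4 → ℤ) i : ℝ) := by
  fin_cases i <;> simp [n, φ₁, φ₂, φ₃, e]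

theorem neg_mem_Δ {α : V} (h : α ∈ Δ) : -α ∈ Δ := by
  rcases h with (h | h) | ⟨s, hs, rfl⟩
  · obtain ⟨i, h⟩ := Set.mem_iUnion.1 h
    refine Or.inl (Or.inl (Set.mem_iUnion.2 ⟨i, ?_⟩))
    rcases h with rfl | rfl <;> simp
  · simp only [Set.mem_iUnion] at h
    obtain ⟨i, j, hij, h⟩ := h
    refine Or.inl (Or.inr ?_)
    simp only [Set.mem_iUnion]
    refine ⟨i, j, hij, ?_⟩
    rcases h with rfl | rfl | rfl | rfl
    · right; right; right; simp only [Set.mem_singleton_iff]; abel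
    · right; right; left; abel
    · right; left; abel
    · left; abel
  · refine Or.inr ⟨-s, fun i => ?_, by simp⟩
    rcases hs i with h | h <;> simp [h]

/-- Twice the roots of type F₄, in standard coordinates: the vectors of squared length 4 or 8
whose entries all have the same parity. -/
def doubledRoots : Finset (Fin 4 → ℤ) :=
  {w ∈ Fintype.piFinset fun _ => Finset.Icc (-2) 2 |
    (∀ i, w i % 2 = w 0 % 2) ∧ (∑ i, w i ^ 2 = 4 ∨ ∑ i, w i ^ 2 = 8)}

/-- Simple root coordinates of half an integral vector. -/
def simpleCoord (w : Fin 4 → ℤ) : Fin 4 → ℤ :=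
  ![(w 1 + w 0) / 2, (w 1 + w 2 + 2 * w 0) / 2, (w 1 + w 2 + w 3 + 3 * w 0) / 2, w 0]

theorem exists_doubledRoots_eq {α : V} (h : α ∈ Δ) : ∃ w ∈ doubledRoots, ∀ i, 2 * α i = w i := by
  have short (i : Fin 4) : Pi.single i 2 ∈ doubledRoots ∧ Pi.single i (-2) ∈ doubledRoots := by
    simp only [doubledRoots, Finset.mem_filter, Fintype.mem_piFinset, Finset.mem_Icc]
    revert i; decide +kernel
  have long : ∀ i j : Fin 4, i < j → ∀ a ∈ ({2, -2} : Finset ℤ), ∀ b ∈ ({2, -2} : Finset ℤ),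
      Pi.single i a + Pi.single j b ∈ doubledRoots := by
    simp only [doubledRoots, Finset.mem_filter, Fintype.mem_piFinset, Finset.mem_Icc]
    decide +kernel
  rcases h with (h | h) | ⟨s, hs, rfl⟩
  · obtain ⟨i, h⟩ := Set.mem_iUnion.1 h
    rcases h with rfl | rfl
    · exact ⟨_, (short i).1, fun k => by by_cases k = i <;> simp_all [e]⟩
    · exact ⟨_, (short i).2, fun k => by by_cases k = i <;> simp_all [e]⟩
  · simp only [Set.mem_iUnion] at h
    obtain ⟨i, j, hij, h⟩ := h
    rcases h with rfl | rfl | rfl | rfl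
    · refine ⟨_, long i j hij 2 (by simp) 2 (by simp), fun k => ?_⟩
      simp only [e, Pi.add_apply, Pi.single_apply]; split_ifs <;> norm_num
    · refine ⟨_, long i j hij 2 (by simp) (-2) (by simp), fun k => ?_⟩
      simp only [e, Pi.add_apply, Pi.sub_apply, Pi.single_apply]; split_ifs <;> norm_num
    · refine ⟨_, long i j hij (-2) (by simp) 2 (by simp), fun k => ?_⟩
      simp only [e, Pi.add_apply, Pi.neg_apply, Pi.single_apply]; split_ifs <;> norm_num
    · refine ⟨_, long i j hij (-2) (by simp) (-2) (by simp), fun k => ?_⟩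
      simp only [e, Pi.add_apply, Pi.sub_apply, Pi.neg_apply, Pi.single_apply]
      split_ifs <;> norm_num
  · have (i : Fin 4) : ∃ t : ℤ, (t = 1 ∨ t = -1) ∧ s i = t := by
      rcases hs i with h | h
      · exact ⟨1, by simp, by simp [h]⟩
      · exact ⟨-1, by simp, by simp [h]⟩
    choose t ht hst using this
    refine ⟨t, ?_, fun k => ?_⟩
    · have hsq (i : Fin 4) : t i ^ 2 = 1 := by rcases ht i with h | h <;> simp [h]
      simp only [doubledRoots, Finset.mem_filter, Fintype.mem_piFinset, Finset.mem_Icc, hsq]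
      refine ⟨fun i => ?_, fun i => ?_, by simp⟩
      · have := ht i; omega
      · have := ht i; have := ht 0; omega
    · simp [hst, e, Pi.single_apply]

theorem exists_simpleCoord_eq {α : V} (h : α ∈ Δ) :
    ∃ w ∈ doubledRoots, ∀ i, n α i = simpleCoord w i := by
  obtain ⟨w, hw, hα⟩ := exists_doubledRoots_eq h
  refine ⟨w, hw, ?_⟩
  have parity := (Finset.mem_filter.1 hw).2.1
  have h1 := parity 1
  have h2 := parity 2
  have h3 := parity 3
  have half {a b : ℤ} (h : a = 2 * b) : a / 2 = b := by omega
  have e0 := hα 0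
  have e1 := hα 1
  have e2 := hα 2
  have e3 := hα 3
  obtain ⟨a, ha⟩ : ∃ a, w 1 + w 0 = 2 * a := ⟨(w 1 + w 0) / 2, by omega⟩
  obtain ⟨b, hb⟩ : ∃ b, w 1 + w 2 + 2 * w 0 = 2 * b := ⟨(w 1 + w 2 + 2 * w 0) / 2, by omega⟩
  obtain ⟨c, hc⟩ : ∃ c, w 1 + w 2 + w 3 + 3 * w 0 = 2 * c :=
    ⟨(w 1 + w 2 + w 3 + 3 * w 0) / 2, by omega⟩
  simp only [simpleCoord, half ha, half hb, half hc]
  have ha' : (w 1 + w 0 : ℝ) = 2 * a := by exact_mod_cast ha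
  have hb' : (w 1 + w 2 + 2 * w 0 : ℝ) = 2 * b := by exact_mod_cast hb
  have hc' : (w 1 + w 2 + w 3 + 3 * w 0 : ℝ) = 2 * c := by exact_mod_cast hc
  intro i
  fin_cases i <;> simp [n] <;> linarith

/-- The base `φ₁+φ₂+φ₃+φ₄, −(φ₁+2φ₂+2φ₃), φ₂, φ₃` as an indexed family. -/
def newBase : Fin 4 → V :=
  ![φ₁ + φ₂ + φ₃ + φ₄, -(φ₁ + (2 : ℝ) • φ₂ + (2 : ℝ) • φ₃), φ₂, φ₃]

/-- Coordinates with respect to `newBase` in terms of simple root coordinates. -/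
def baseCoord {R : Type*} [CommRing R] (z : Fin 4 → R) : Fin 4 → R :=
  ![z 3, z 3 - z 0, z 1 + z 3 - 2 * z 0, z 2 + z 3 - 2 * z 0]

theorem eq_sum_newBase_iff (α : V) (c : Fin 4 → ℝ) :
    α = ∑ i, c i • newBase i ↔ ∀ i, baseCoord (n α) i = c i := by
  constructor
  · rintro rfl i
    fin_cases i <;>
      simp [n, newBase, baseCoord, φ₁, φ₂, φ₃, φ₄, e, Fin.sum_univ_four] <;> ring
  · intro h
    ext j
    simp only [← h]
    fin_cases j <;>
      simp [n, newBase, baseCoord, φ₁, φ₂, φ₃, φ₄, e, Fin.sum_univ_four] <;> ring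

theorem linearIndependent_newBase : LinearIndependent ℝ newBase := by
  refine Fintype.linearIndependent_iff.2 fun g hg i => ?_
  rw [← (eq_sum_newBase_iff 0 g).1 hg.symm i]
  fin_cases i <;> simp [baseCoord, n]

theorem coe_baseCoord (z : Fin 4 → ℤ) (i : Fin 4) :
    baseCoord (fun j => (z j : ℝ)) i =
    ((baseCoord z i : ℤ) : ℝ) := by
  fin_cases i <;> simp [baseCoord]

theorem image_newBase : ({φ₁ + φ₂ + φ₃ + φ₄, -(φ₁ + (2 : ℝ) • φ₂ + (2 : ℝ) • φ₃), φ₂, φ₃} : Finset V)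
    = Finset.univ.image newBase := by
  ext x
  simp [newBase, Fin.exists_fin_succ, eq_comm]

theorem eq_sum_image_newBase_iff {α : V} {z : Fin 4 → ℤ} (hz : ∀ i, n α i = z i) (c : V → ℤ) :
    α = ∑ x ∈ Finset.univ.image newBase, (c x : ℝ) • x ↔ ∀ i, c (newBase i) = baseCoord z i := by
  rw [Finset.sum_image linearIndependent_newBase.injective.injOn,
    eq_sum_newBase_iff α fun i => (c (newBase i) : ℝ), funext hz]
  simp only [coe_baseCoord, Int.cast_inj, eq_comm]

theorem exists_eq_sum_image_newBase {α : V} {z : Fin 4 → ℤ} (hz : ∀ i, n α i = z i) :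
    ∃ c : V → ℤ, α = ∑ x ∈ Finset.univ.image newBase, (c x : ℝ) • x := by
  refine ⟨Function.extend newBase (baseCoord z) 0, (eq_sum_image_newBase_iff hz _).2 fun i => ?_⟩
  exact linearIndependent_newBase.injective.extend_apply _ _ _

theorem mem_posOf_newBase_iff {α : V} {z : Fin 4 → ℤ} (hα : α ∈ Δ) (hz : ∀ i, n α i = z i) :
    α ∈ posOf (Finset.univ.image newBase) ↔ ∀ i, 0 ≤ baseCoord z i := by
  constructor
  · rintro ⟨-, c, hc, hpos⟩ i
    rw [← (eq_sum_image_newBase_iff hz c).1 hc i]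
    exact hpos _ (Finset.mem_image_of_mem _ (Finset.mem_univ i))
  · intro h
    obtain ⟨c, hc⟩ := exists_eq_sum_image_newBase hz
    refine ⟨hα, c, hc, ?_⟩
    simpa [(eq_sum_image_newBase_iff hz c).1 hc] using h

theorem newBase_mem_Δ (i : Fin 4) : newBase i ∈ Δ := by
  fin_cases i
  · refine Or.inr ⟨![1, 1, -1, -1], fun i => by fin_cases i <;> simp, ?_⟩
    ext j
    fin_cases j <;> simp [newBase, φ₁, φ₂, φ₃, φ₄, e, Fin.sum_univ_four]
    norm_num
  · refine Or.inl (Or.inr ?_)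
    simp only [Set.mem_iUnion]
    refine ⟨1, 2, by decide, Or.inr (Or.inr (Or.inr ?_))⟩
    ext j
    fin_cases j <;> simp [newBase, φ₁, φ₂, φ₃, e]
    norm_num
  · refine Or.inl (Or.inr ?_)
    simp only [Set.mem_iUnion]
    exact ⟨2, 3, by decide, Or.inr (Or.inl rfl)⟩
  · exact Or.inl (Or.inl (Set.mem_iUnion.2 ⟨3, Or.inl rfl⟩))

theorem isBase_newBase : IsBase (Finset.univ.image newBase) := by
  refine ⟨?_, ?_, fun α hα => ?_⟩
  · simpa [Set.range_subset_iff] using newBase_mem_Δ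
  · have := linearIndependent_newBase.linearIndepOn_id
    rw [← Set.image_univ, ← Finset.coe_univ, ← Finset.coe_image] at this
    exact this
  · obtain ⟨w, hw, hz⟩ := exists_simpleCoord_eq hα
    obtain ⟨c, hc⟩ := exists_eq_sum_image_newBase hz
    refine ⟨c, hc, ?_⟩
    have key : ∀ w ∈ doubledRoots, (∀ i, 0 ≤ baseCoord (simpleCoord w) i) ∨
        ∀ i, baseCoord (simpleCoord w) i ≤ 0 := by
      decide +kernel
    simpa [(eq_sum_image_newBase_iff hz c).1 hc] using key w hw

theorem mem_Δp_iff {α : V} {z : Fin 4 → ℤ} (hα : α ∈ Δ) (hz : ∀ i, n α i = z i) :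
    α ∈ Δp ↔ ∀ i, 0 ≤ z i := by
  simp [Δp, hα, hz]

theorem mem_Δk_iff {α : V} {z : Fin 4 → ℤ} (hα : α ∈ Δ) (hz : ∀ i, n α i = z i) :
    α ∈ Δk ↔ z 0 % 2 = 0 := by
  simp only [Δk, Set.mem_ofPred_eq, hα, hz, true_and]
  norm_cast
  exact ⟨by rintro ⟨m, h⟩; omega, fun h => ⟨z 0 / 2, by omega⟩⟩

theorem mem_Δn_iff {α : V} {z : Fin 4 → ℤ} (hα : α ∈ Δ) (hz : ∀ i, n α i = z i) :
    α ∈ Δn ↔ z 0 % 2 = 1 := by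
  simp only [Δn, Set.mem_ofPred_eq, hα, hz, true_and]
  norm_cast
  exact ⟨by rintro ⟨m, h⟩; omega, fun h => ⟨z 0 / 2, by omega⟩⟩

theorem posOf_newBase : posOf (Finset.univ.image newBase) =
    Δkp ∪ {β ∈ Δnp | le' (φ₁ + φ₂ + φ₃ + φ₄) β} ∪
      (Neg.neg '' {β ∈ Δnp | le' β (φ₁ + (2 : ℝ) • φ₂ + (2 : ℝ) • φ₃)}) := by
  have key : ∀ w ∈ doubledRoots, (∀ i, 0 ≤ baseCoord (simpleCoord w) i) ↔
      (((∀ i, 0 ≤ simpleCoord w i) ∧ simpleCoord w 0 % 2 = 0) ∨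
        ((∀ i, 0 ≤ simpleCoord w i) ∧ simpleCoord w 0 % 2 = 1) ∧
          ∀ i, (![1, 1, 1, 1] : Fin 4 → ℤ) i ≤ simpleCoord w i) ∨
      ((∀ i, 0 ≤ -simpleCoord w i) ∧ -simpleCoord w 0 % 2 = 1) ∧
        ∀ i, -simpleCoord w i ≤ (![1, 2, 2, 0] : Fin 4 → ℤ) i := by
    decide +kernel
  ext α
  by_cases hα : α ∈ Δ
  · obtain ⟨w, hw, hz⟩ := exists_simpleCoord_eq hα
    have hz' (i : Fin 4) : n (-α) i = ((-simpleCoord w) i : ℤ) := by simp [n_apply_neg, hz]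
    have hα' := neg_mem_Δ hα
    rw [mem_posOf_newBase_iff hα hz, Set.image_neg_eq_neg]
    simp only [Set.mem_union, Set.mem_neg, Set.mem_ofPred_eq, Δkp, Δnp, Set.mem_inter_iff,
      mem_Δp_iff hα hz, mem_Δk_iff hα hz, mem_Δn_iff hα hz, mem_Δp_iff hα' hz', mem_Δn_iff hα' hz',
      le'_iff n_lower hz, le'_iff hz' n_upper, Pi.neg_apply]
    exact key w hw
  · refine iff_of_false (fun h => hα h.1) ?_
    rintro ((h | h) | ⟨β, h, rfl⟩)
    · exact hα h.1.1
    · exact hα h.1.1.1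
    · exact hα (neg_mem_Δ h.1.1.1)

theorem stmt11 :
    IsBase ({φ₁ + φ₂ + φ₃ + φ₄, -(φ₁ + (2 : ℝ) • φ₂ + (2 : ℝ) • φ₃), φ₂, φ₃} : Finset V) ∧
    posOf ({φ₁ + φ₂ + φ₃ + φ₄, -(φ₁ + (2 : ℝ) • φ₂ + (2 : ℝ) • φ₃), φ₂, φ₃} : Finset V) =
      Δkp ∪ {β ∈ Δnp | le' (φ₁ + φ₂ + φ₃ + φ₄) β} ∪ (Neg.neg '' {β ∈ Δnp | le' β (φ₁ + (2 : ℝ) • φ₂ + (2 : ℝ) • φ₃)}) ∧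
    Δkp ⊆ posOf ({φ₁ + φ₂ + φ₃ + φ₄, -(φ₁ + (2 : ℝ) • φ₂ + (2 : ℝ) • φ₃), φ₂, φ₃} : Finset V) := by
  rw [image_newBase]
  refine ⟨isBase_newBase, posOf_newBase, ?_⟩
  rw [posOf_newBase]
  exact fun α hα => Or.inl (Or.inl hα)
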